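/- For every m ≥ 1 there exists λ ∈ (0,∞)^m with R(λ^ML, λ) > m − 1/2. Consequently, for m ≥ 2 (where sup_λ R(λ^O, λ) = m − 1/2) the maximum likelihood estimator λ^ML is not minimax: sup_{λ ∈ (0,∞)^m} R(λ^ML, λ) > sup_{λ ∈ (0,∞)^m} R(λ^O, λ). -/

import Mathlib

open scoped BigOperators ENNReal

/-- The Poisson(μ) probability of the value `k`. -/
noncomputable def poissonPmf (mu : ℝ) (k : ℕ) : ℝ :=
  mu ^ k * Real.exp (-mu) / (Nat.factorial k)

/-- Joint pmf of (X, Y): X_1, …, X_m, Y independent, X_i ~ Po(λ_i), Y ~ Po(Σ λ_i). -/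
noncomputable def jointPmf (m : ℕ) (lam : Fin m → ℝ) (x : Fin m → ℕ) (y : ℕ) : ℝ :=
  poissonPmf (∑ i, lam i) y * ∏ i, poissonPmf (lam i) (x i)

/-- Risk of an estimator δ under the standardized squared error loss, valued in [0,∞]. -/
noncomputable def risk (m : ℕ) (δ : (Fin m → ℕ) → ℕ → Fin m → ℝ) (lam : Fin m → ℝ) : ℝ≥0∞ :=
  ∑' x : Fin m → ℕ, ∑' y : ℕ,
    ENNReal.ofReal ((∑ i, (δ x y i - lam i) ^ 2 / lam i) * jointPmf m lam x y)

/-- The maximum likelihood estimator λ^ML (real division by zero is 0, giving 0/0 = 0). -/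
noncomputable def estML (m : ℕ) (x : Fin m → ℕ) (y : ℕ) (i : Fin m) : ℝ :=
  ((∑ j, (x j : ℝ)) + (y : ℝ)) / 2 * ((x i : ℝ) / ∑ j, (x j : ℝ))

/-- The shrinkage estimator λ^O. -/
noncomputable def estO (m : ℕ) (x : Fin m → ℕ) (y : ℕ) (i : Fin m) : ℝ :=
  ((∑ j, (x j : ℝ)) + (y : ℝ) + (m : ℝ) - 1) / 2 *
    ((x i : ℝ) / ((∑ j, (x j : ℝ)) + (m : ℝ) - 1))

/-- The second shrinkage estimator λ̂. -/
noncomputable def estHat (m : ℕ) (x : Fin m → ℕ) (y : ℕ) (i : Fin m) : ℝ :=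
  ((∑ j, (x j : ℝ)) + (y : ℝ)) / 2 * ((x i : ℝ) / ((∑ j, (x j : ℝ)) + (m : ℝ) - 1))

/-- The Clevenson–Zidek estimator λ̂X based on X alone. -/
noncomputable def estCZ (m : ℕ) (x : Fin m → ℕ) (y : ℕ) (i : Fin m) : ℝ :=
  (∑ j, (x j : ℝ)) * (x i : ℝ) / ((∑ j, (x j : ℝ)) + (m : ℝ) - 1)

section PoissonWeights

variable {m : ℕ} {lam : Fin m → ℝ}

theorem poissonPmf_nonneg {mu : ℝ} (hmu : 0 ≤ mu) (k : ℕ) : 0 ≤ poissonPmf mu k := by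
  unfold poissonPmf; positivity

theorem hasSum_poissonPmf (mu : ℝ) : HasSum (poissonPmf mu) 1 := by
  convert! (NormedSpace.expSeries_div_hasSum_exp mu).mul_right (Real.exp (-mu)) using 1
  · funext k
    rw [poissonPmf]
    ring
  · rw [← Real.exp_eq_exp_ℝ, ← Real.exp_add, add_neg_cancel, Real.exp_zero]

theorem succ_mul_poissonPmf_succ (mu : ℝ) (k : ℕ) :
    ((k : ℝ) + 1) * poissonPmf mu (k + 1) = mu * poissonPmf mu k := by
  unfold poissonPmf
  rw [Nat.factorial_succ]
  have : ((k : ℝ) + 1) ≠ 0 := by positivity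
  push_cast
  field_simp
  ring

/-- The identity `E[Y g(Y)] = μ E[g(Y + 1)]` for `Y ~ Po(μ)`. -/
theorem hasSum_nat_mul_poissonPmf {mu : ℝ} {g : ℕ → ℝ} {v : ℝ}
    (h : HasSum (fun k => g (k + 1) * poissonPmf mu k) v) :
    HasSum (fun k : ℕ => (k : ℝ) * g k * poissonPmf mu k) (mu * v) := by
  rw [← hasSum_nat_add_iff' 1]
  convert! h.mul_left mu using 1
  · funext k
    push_cast
    linear_combination g (k + 1) * succ_mul_poissonPmf_succ mu k
  · simp

theorem hasSum_quadratic_mul_poissonPmf (mu a b c : ℝ) :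
    HasSum (fun k : ℕ => (a + b * k + c * (k : ℝ) ^ 2) * poissonPmf mu k)
      (a + b * mu + c * (mu + mu ^ 2)) := by
  have h0 := hasSum_poissonPmf mu
  have h1 := hasSum_nat_mul_poissonPmf (g := fun _ => 1) (by simpa using h0)
  have h2 := hasSum_nat_mul_poissonPmf (mu := mu) (g := fun k => (k : ℝ)) (v := mu + 1) (by
    convert! h1.add h0 using 1
    · funext k
      push_cast
      ring
    · ring)
  convert! ((h0.mul_left a).add (h1.mul_left b)).add (h2.mul_left c) using 1
  · funext k
    ring
  · ring

theorem hasSum_pi_prod_of_nonneg {ι : Type*} {n : ℕ} {f : Fin n → ι → ℝ} {a : Fin n → ℝ}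
    (hf : ∀ i j, 0 ≤ f i j) (h : ∀ i, HasSum (f i) (a i)) :
    HasSum (fun x : Fin n → ι => ∏ i, f i (x i)) (∏ i, a i) := by
  induction n with
  | zero => simp
  | succ n ih =>
    have ih := ih (f := fun i => f i.succ) (fun i => hf _) (fun i => h _)
    have hs := (h 0).summable.mul_of_nonneg ih.summable (hf 0)
      (fun x => Finset.prod_nonneg fun i _ => hf _ _)
    rw [← (Fin.consEquiv fun _ : Fin (n + 1) => ι).hasSum_iff, Fin.prod_univ_succ]
    convert! (h 0).mul ih hs using 1
    funext p
    simp [Fin.prod_univ_succ, Fin.consEquiv]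

/-- The joint pmf of independent `X_i ~ Po(λ_i)`. -/
noncomputable def poissonWeight (lam : Fin m → ℝ) (x : Fin m → ℕ) : ℝ :=
  ∏ i, poissonPmf (lam i) (x i)

theorem poissonWeight_nonneg (hlam : ∀ i, 0 < lam i) (x : Fin m → ℕ) :
    0 ≤ poissonWeight lam x :=
  Finset.prod_nonneg fun i _ => poissonPmf_nonneg (hlam i).le _

theorem hasSum_poissonWeight (hlam : ∀ i, 0 < lam i) : HasSum (poissonWeight lam) 1 := by
  have h := hasSum_pi_prod_of_nonneg (f := fun i => poissonPmf (lam i))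
    (fun i j => poissonPmf_nonneg (hlam i).le j) (fun i => hasSum_poissonPmf (lam i))
  rwa [Finset.prod_const_one] at h

theorem poissonWeight_zero : poissonWeight lam 0 = Real.exp (-∑ i, lam i) := by
  simp [poissonWeight, poissonPmf, ← Real.exp_sum]

theorem summable_mul_poissonWeight_of_bounded (hlam : ∀ i, 0 < lam i) {f : (Fin m → ℕ) → ℝ}
    {C : ℝ} (hf : ∀ x, |f x| ≤ C) : Summable (fun x => f x * poissonWeight lam x) := by
  refine Summable.of_norm_bounded ((hasSum_poissonWeight hlam).summable.mul_left C) fun x => ?_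
  rw [Real.norm_eq_abs, abs_mul, abs_of_nonneg (poissonWeight_nonneg hlam x)]
  exact mul_le_mul_of_nonneg_right (hf x) (poissonWeight_nonneg hlam x)

theorem poissonWeight_add_single (x : Fin m → ℕ) (i : Fin m) :
    ((x i : ℝ) + 1) * poissonWeight lam (x + Pi.single i 1) = lam i * poissonWeight lam x := by
  unfold poissonWeight
  rw [← Finset.mul_prod_erase _ _ (Finset.mem_univ i),
    ← Finset.mul_prod_erase _ _ (Finset.mem_univ i), ← mul_assoc, ← mul_assoc]
  congr 1
  · simpa using succ_mul_poissonPmf_succ (lam i) (x i)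
  · refine Finset.prod_congr rfl fun j hj => ?_
    simp [Finset.ne_of_mem_erase hj]

/-- The identity `E[X_i g(X)] = λ_i E[g(X + e_i)]` for independent `X_i ~ Po(λ_i)`. -/
theorem hasSum_coord_mul_poissonWeight {g : (Fin m → ℕ) → ℝ} {v : ℝ} (i : Fin m)
    (h : HasSum (fun x => g (x + Pi.single i 1) * poissonWeight lam x) v) :
    HasSum (fun x => (x i : ℝ) * g x * poissonWeight lam x) (lam i * v) := by
  have hinj : Function.Injective (fun x : Fin m → ℕ => x + Pi.single i 1) :=
    add_left_injective _
  rw [← hinj.hasSum_iff]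
  · convert! h.mul_left (lam i) using 1
    funext x
    have := poissonWeight_add_single (lam := lam) x i
    simp only [Function.comp_apply, Pi.add_apply, Pi.single_eq_same]
    push_cast
    linear_combination g (x + Pi.single i 1) * this
  · intro x hx
    have : x i = 0 := by
      by_contra hne
      refine hx ⟨x - Pi.single i 1, ?_⟩
      funext j
      rcases eq_or_ne j i with rfl | hj
      · simp only [Pi.add_apply, Pi.sub_apply, Pi.single_eq_same]
        omega
      · simp [hj]
    simp [this]

theorem sum_cast_add_single (x : Fin m → ℕ) (i : Fin m) :
    ∑ j, ((x + Pi.single i 1 : Fin m → ℕ) j : ℝ) = ∑ j, (x j : ℝ) + 1 := by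
  simp only [Pi.add_apply, Nat.cast_add, Finset.sum_add_distrib]
  congr 1
  rw [← Nat.cast_sum, Finset.sum_pi_single']
  simp

/-- The identity `E[N g(N)] = Λ E[g(N + 1)]` for the total count `N`. -/
theorem hasSum_total_mul_poissonWeight {g : ℝ → ℝ} {v : ℝ}
    (h : HasSum (fun x => g (∑ j, (x j : ℝ) + 1) * poissonWeight lam x) v) :
    HasSum (fun x => (∑ j, (x j : ℝ)) * g (∑ j, (x j : ℝ)) * poissonWeight lam x)
      ((∑ i, lam i) * v) := by
  have := hasSum_sum (s := Finset.univ) fun i _ =>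
    hasSum_coord_mul_poissonWeight (lam := lam) (g := fun x => g (∑ j, (x j : ℝ))) (v := v) i
      (by simpa only [sum_cast_add_single] using h)
  simpa only [Finset.sum_mul] using this

theorem hasSum_total (hlam : ∀ i, 0 < lam i) :
    HasSum (fun x => (∑ j, (x j : ℝ)) * poissonWeight lam x) (∑ i, lam i) := by
  simpa only [mul_one] using hasSum_total_mul_poissonWeight (g := fun _ => 1) (v := 1)
    (by simpa using hasSum_poissonWeight hlam)

/-- The estimator `((N + Y + k) / 2) · x_i / (N + k)`. -/
noncomputable def estShift (k : ℝ) (x : Fin m → ℕ) (y : ℕ) (i : Fin m) : ℝ :=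
  ((∑ j, (x j : ℝ)) + k + y) / 2 * ((x i : ℝ) / ((∑ j, (x j : ℝ)) + k))

theorem sum_estShift_loss (hlam : ∀ i, 0 < lam i) (k : ℝ) (x : Fin m → ℕ) (y : ℕ) :
    ∑ i, (estShift k x y i - lam i) ^ 2 / lam i =
      (((∑ j, (x j : ℝ)) + k + y) / 2 / ((∑ j, (x j : ℝ)) + k)) ^ 2 * ∑ i, (x i : ℝ) ^ 2 / lam i
        - 2 * (((∑ j, (x j : ℝ)) + k + y) / 2 / ((∑ j, (x j : ℝ)) + k)) * ∑ i, (x i : ℝ)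
        + ∑ i, lam i := by
  rw [Finset.mul_sum, Finset.mul_sum, ← Finset.sum_sub_distrib, ← Finset.sum_add_distrib]
  refine Finset.sum_congr rfl fun i _ => ?_
  have := (hlam i).ne'
  have e : estShift k x y i =
      ((∑ j, (x j : ℝ)) + k + y) / 2 / ((∑ j, (x j : ℝ)) + k) * x i := by
    unfold estShift
    ring
  rw [e]
  generalize ((∑ j, (x j : ℝ)) + k + y) / 2 / ((∑ j, (x j : ℝ)) + k) = r
  field_simp
  ring

/-- The mean of the squared shrinkage factor given the shifted total `s`. -/
noncomputable def factorSq (L s : ℝ) : ℝ :=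
  (s / s / 2) ^ 2 + s / s / 2 * L / s + (L + L ^ 2) / (2 * s) ^ 2

/-- The mean of the shrinkage factor given the shifted total `s`. -/
noncomputable def factorMean (L s : ℝ) : ℝ := s / s / 2 + L / (2 * s)

theorem hasSum_estShift_loss (hlam : ∀ i, 0 < lam i) (k : ℝ) (x : Fin m → ℕ) :
    HasSum (fun y => (∑ i, (estShift k x y i - lam i) ^ 2 / lam i) * jointPmf m lam x y)
      ((factorSq (∑ i, lam i) ((∑ j, (x j : ℝ)) + k) * ∑ i, (x i : ℝ) ^ 2 / lam i
        - 2 * factorMean (∑ i, lam i) ((∑ j, (x j : ℝ)) + k) * ∑ i, (x i : ℝ)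
        + ∑ i, lam i) * poissonWeight lam x) := by
  have hj : ∀ y, jointPmf m lam x y = poissonPmf (∑ i, lam i) y * poissonWeight lam x :=
    fun _ => rfl
  simp only [sum_estShift_loss hlam, hj]
  set s := (∑ j, (x j : ℝ)) + k
  set n := ∑ j, (x j : ℝ)
  set Q := ∑ i, (x i : ℝ) ^ 2 / lam i
  set L := ∑ i, lam i
  have h := (hasSum_quadratic_mul_poissonPmf L ((s / s / 2) ^ 2 * Q - 2 * (s / s / 2) * n + L)
    (2 * (s / s / 2) * (1 / (2 * s)) * Q - 2 * (1 / (2 * s)) * n) ((1 / (2 * s)) ^ 2 * Q)).mul_right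
    (poissonWeight lam x)
  convert! h using 1
  · funext y
    ring
  · unfold factorSq factorMean
    ring

theorem factorSq_of_pos (L : ℝ) {s : ℝ} (hs : 0 < s) :
    factorSq L s = 1 / 4 + L / 2 * (1 / s) + (L + L ^ 2) / 4 * (1 / s) ^ 2 := by
  unfold factorSq
  field_simp
  ring

theorem factorMean_of_pos (L : ℝ) {s : ℝ} (hs : 0 < s) :
    factorMean L s = 1 / 2 + L / 2 * (1 / s) := by
  unfold factorMean
  field_simp

theorem total_nonneg (x : Fin m → ℕ) : 0 ≤ ∑ j, (x j : ℝ) :=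
  Finset.sum_nonneg fun _ _ => Nat.cast_nonneg _

theorem one_div_total_le {k : ℝ} (hk : 0 ≤ k) (x : Fin m → ℕ) :
    1 / ((∑ j, (x j : ℝ)) + 1 + k) ≤ 1 := by
  have := total_nonneg x
  rw [div_le_one (by positivity)]
  linarith

theorem summable_one_div_total (hlam : ∀ i, 0 < lam i) {k : ℝ} (hk : 0 ≤ k) :
    Summable (fun x => 1 / ((∑ j, (x j : ℝ)) + 1 + k) * poissonWeight lam x) :=
  summable_mul_poissonWeight_of_bounded hlam (C := 1) fun x => by
    have := total_nonneg x
    rw [abs_of_nonneg (by positivity)]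
    exact one_div_total_le hk x

theorem summable_one_div_total_sq (hlam : ∀ i, 0 < lam i) {k : ℝ} (hk : 0 ≤ k) :
    Summable (fun x => (1 / ((∑ j, (x j : ℝ)) + 1 + k)) ^ 2 * poissonWeight lam x) :=
  summable_mul_poissonWeight_of_bounded hlam (C := 1) fun x => by
    have := total_nonneg x
    rw [abs_of_nonneg (by positivity)]
    exact pow_le_one₀ (by positivity) (one_div_total_le hk x)

theorem summable_factorSq_mul_coord (hlam : ∀ i, 0 < lam i) {k : ℝ} (hk : 0 ≤ k) (i : Fin m) :
    Summable (fun x => factorSq (∑ i, lam i) ((∑ j, (x j : ℝ)) + 1 + k) * ((x i : ℝ) + 1)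
      * poissonWeight lam x) := by
  set L := ∑ i, lam i
  have hL : 0 ≤ L := Finset.sum_nonneg fun i _ => (hlam i).le
  have h1 := (hasSum_coord_mul_poissonWeight (lam := lam) (g := fun _ => 1) i
    (by simpa using hasSum_poissonWeight hlam)).summable
  have h2 := (h1.add (hasSum_poissonWeight hlam).summable).mul_left
    (1 / 4 + L / 2 + (L + L ^ 2) / 4)
  refine Summable.of_nonneg_of_le (fun x => ?_) (fun x => ?_) h2
  · have := total_nonneg x
    have := poissonWeight_nonneg hlam x
    unfold factorSq
    positivity
  · have := total_nonneg x
    have hw := poissonWeight_nonneg hlam x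
    rw [factorSq_of_pos L (by positivity)]
    have h3 := one_div_total_le hk x
    have h4 : 0 ≤ 1 / ((∑ j, (x j : ℝ)) + 1 + k) := by positivity
    have h5 : (1 / ((∑ j, (x j : ℝ)) + 1 + k)) ^ 2 ≤ 1 := pow_le_one₀ h4 h3
    calc _ ≤ (1 / 4 + L / 2 * 1 + (L + L ^ 2) / 4 * 1) * ((x i : ℝ) + 1) * poissonWeight lam x := by
          gcongr
      _ = _ := by ring

theorem risk_estShift (hlam : ∀ i, 0 < lam i) {k V t : ℝ} (hk : 0 ≤ k)
    (hV : HasSum (fun x => factorSq (∑ i, lam i) ((∑ j, (x j : ℝ)) + 1 + k)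
      * ((∑ j, (x j : ℝ)) + m) * poissonWeight lam x) V)
    (ht : HasSum (fun x => 1 / ((∑ j, (x j : ℝ)) + 1 + k) * poissonWeight lam x) t) :
    risk m (estShift k) lam = ENNReal.ofReal (V - (∑ i, lam i) ^ 2 * t) := by
  have hnonneg : ∀ x y, 0 ≤ (∑ i, (estShift k x y i - lam i) ^ 2 / lam i) * jointPmf m lam x y := by
    intro x y
    refine mul_nonneg (Finset.sum_nonneg fun i _ => div_nonneg (sq_nonneg _) (hlam i).le)
      (mul_nonneg (poissonPmf_nonneg ?_ y) (poissonWeight_nonneg hlam x))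
    exact Finset.sum_nonneg fun i _ => (hlam i).le
  have hin := hasSum_estShift_loss hlam k
  unfold risk
  simp only [fun x => (ENNReal.ofReal_tsum_of_nonneg (hnonneg x) (hin x).summable).symm,
    fun x => (hin x).tsum_eq]
  have hsum := summable_factorSq_mul_coord hlam hk
  set L := ∑ i, lam i
  have hsq : ∀ i, HasSum (fun x : Fin m → ℕ => (x i : ℝ) * (factorSq L ((∑ j, (x j : ℝ)) + k) * x i)
      * poissonWeight lam x) (lam i * ∑' x : Fin m → ℕ,
        factorSq L ((∑ j, (x j : ℝ)) + 1 + k) * ((x i : ℝ) + 1) * poissonWeight lam x) := by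
    intro i
    refine hasSum_coord_mul_poissonWeight
      (g := fun x => factorSq L ((∑ j, (x j : ℝ)) + k) * x i) i ?_
    simp only [sum_cast_add_single]
    simpa only [Pi.add_apply, Pi.single_eq_same, Nat.cast_add, Nat.cast_one]
      using (hsum i).hasSum
  have hV' : ∑ i, ∑' x : Fin m → ℕ, factorSq L ((∑ j, (x j : ℝ)) + 1 + k) * ((x i : ℝ) + 1)
      * poissonWeight lam x = V := by
    refine (hasSum_sum fun i _ => (hsum i).hasSum).unique ?_
    convert! hV using 1
    funext x
    rw [← Finset.sum_mul, ← Finset.mul_sum, Finset.sum_add_distrib]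
    simp
  have hQ : HasSum (fun x : Fin m → ℕ => factorSq L ((∑ j, (x j : ℝ)) + k)
      * (∑ i, (x i : ℝ) ^ 2 / lam i) * poissonWeight lam x) V := by
    rw [← hV']
    convert! hasSum_sum (s := Finset.univ) fun i _ => (hsq i).mul_left (lam i)⁻¹ using 1
    · funext x
      rw [Finset.mul_sum, Finset.sum_mul]
      refine Finset.sum_congr rfl fun i _ => ?_
      ring
    · refine Finset.sum_congr rfl fun i _ => ?_
      rw [inv_mul_cancel_left₀ (hlam i).ne']
  have hN : HasSum (fun x : Fin m → ℕ => (∑ j, (x j : ℝ)) * factorMean L ((∑ j, (x j : ℝ)) + k)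
      * poissonWeight lam x) (L * (1 / 2 * 1 + L / 2 * t)) := by
    refine hasSum_total_mul_poissonWeight (g := fun n => factorMean L (n + k)) ?_
    convert! ((hasSum_poissonWeight hlam).mul_left (1 / 2)).add (ht.mul_left (L / 2)) using 1
    funext x
    have := total_nonneg x
    rw [factorMean_of_pos L (by positivity)]
    ring
  have hG : HasSum (fun x : Fin m → ℕ => (factorSq L ((∑ j, (x j : ℝ)) + k)
      * ∑ i, (x i : ℝ) ^ 2 / lam i - 2 * factorMean L ((∑ j, (x j : ℝ)) + k) * ∑ i, (x i : ℝ) + L)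
        * poissonWeight lam x) (V - L ^ 2 * t) := by
    convert! (hQ.sub (hN.mul_left 2)).add ((hasSum_poissonWeight hlam).mul_left L) using 1
    · funext x
      ring
    · ring
  rw [← ENNReal.ofReal_tsum_of_nonneg (fun x => ?_) hG.summable, hG.tsum_eq]
  exact (hin x).nonneg (hnonneg x)

theorem hasSum_one_div_total_succ (hlam : ∀ i, 0 < lam i) (hL : ∑ i, lam i ≠ 0) :
    HasSum (fun x => 1 / ((∑ j, (x j : ℝ)) + 1) * poissonWeight lam x)
      ((1 - Real.exp (-∑ i, lam i)) / ∑ i, lam i) := by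
  have hs : Summable (fun x => 1 / ((∑ j, (x j : ℝ)) + 1) * poissonWeight lam x) := by
    simpa using summable_one_div_total hlam le_rfl
  have h1 := hasSum_total_mul_poissonWeight (lam := lam) (g := fun n => 1 / n) hs.hasSum
  have h2 := (hasSum_poissonWeight hlam).sub (hasSum_ite_eq (0 : Fin m → ℕ) (poissonWeight lam 0))
  have h3 := h1.unique (by
    convert! h2 using 1
    funext x
    by_cases hx : x = 0
    · simp [hx]
    · have : ∑ j, (x j : ℝ) ≠ 0 := by
        rw [← Nat.cast_sum, Nat.cast_ne_zero]
        contrapose! hx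
        funext j
        simpa using (Finset.sum_eq_zero_iff.mp hx) j (Finset.mem_univ j)
      simp [hx, this])
  rw [poissonWeight_zero] at h3
  rw [← h3, mul_div_cancel_left₀ _ hL]
  exact hs.hasSum

theorem hasSum_one_div_total_succ_mul (hlam : ∀ i, 0 < lam i) (hL : ∑ i, lam i ≠ 0) :
    HasSum (fun x => 1 / (((∑ j, (x j : ℝ)) + 1) * ((∑ j, (x j : ℝ)) + 2)) * poissonWeight lam x)
      (((1 - Real.exp (-∑ i, lam i)) / (∑ i, lam i) - Real.exp (-∑ i, lam i)) / ∑ i, lam i) := by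
  have hs : Summable (fun x =>
      1 / (((∑ j, (x j : ℝ)) + 1) * ((∑ j, (x j : ℝ)) + 2)) * poissonWeight lam x) :=
    summable_mul_poissonWeight_of_bounded hlam (C := 1) fun x => by
      have := total_nonneg x
      rw [abs_of_nonneg (by positivity), div_le_one (by positivity)]
      nlinarith
  have h1 := hasSum_total_mul_poissonWeight (lam := lam) (g := fun n => 1 / (n * (n + 1)))
    (by simpa only [add_assoc, one_add_one_eq_two] using hs.hasSum)
  have h2 := (hasSum_one_div_total_succ hlam hL).sub
    (hasSum_ite_eq (0 : Fin m → ℕ) (poissonWeight lam 0))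
  have h3 := h1.unique (by
    convert! h2 using 1
    funext x
    by_cases hx : x = 0
    · simp [hx]
    · have h0 : ∑ j, (x j : ℝ) ≠ 0 := by
        rw [← Nat.cast_sum, Nat.cast_ne_zero]
        contrapose! hx
        funext j
        simpa using (Finset.sum_eq_zero_iff.mp hx) j (Finset.mem_univ j)
      have := total_nonneg x
      have h4 : ∑ j, (x j : ℝ) + 1 ≠ 0 := by positivity
      simp only [hx, if_false, sub_zero]
      field_simp)
  rw [poissonWeight_zero] at h3
  rw [← h3, mul_div_cancel_left₀ _ hL]
  exact hs.hasSum

theorem estML_eq_estShift : estML m = estShift 0 := by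
  funext x y i
  simp [estML, estShift]

theorem estO_eq_estShift : estO m = estShift ((m : ℝ) - 1) := by
  funext x y i
  unfold estO estShift
  ring

theorem lt_risk_estML (hm : 1 ≤ m) (hlam : ∀ i, 0 < lam i) (hL : ∑ i, lam i = 4) :
    ENNReal.ofReal ((m : ℝ) - 1 / 2) < risk m (estML m) lam := by
  have hm' : (1 : ℝ) ≤ m := by exact_mod_cast hm
  have h0 := hasSum_poissonWeight hlam
  have h1 := hasSum_one_div_total_succ hlam (by rw [hL]; norm_num)
  have h2 := hasSum_one_div_total_succ_mul hlam (by rw [hL]; norm_num)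
  have hN := hasSum_total hlam
  have hs : Summable (fun x => (1 / ((∑ j, (x j : ℝ)) + 1)) ^ 2 * poissonWeight lam x) := by
    simpa using summable_one_div_total_sq hlam le_rfl
  have hle := hasSum_le (fun x => by
    have := total_nonneg x
    refine mul_le_mul_of_nonneg_right ?_ (poissonWeight_nonneg hlam x)
    rw [div_pow, one_pow]
    apply one_div_le_one_div_of_le (by positivity)
    nlinarith) h2 hs.hasSum
  set u := ∑' x : Fin m → ℕ, (1 / ((∑ j, (x j : ℝ)) + 1)) ^ 2 * poissonWeight lam x
  rw [hL] at h1 hle hN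
  set q := Real.exp (-4)
  have hV : HasSum (fun x => factorSq (∑ i, lam i) ((∑ j, (x j : ℝ)) + 1 + 0)
      * ((∑ j, (x j : ℝ)) + m) * poissonWeight lam x)
      (13 / 4 + 5 * ((1 - q) / 4) + ((m : ℝ) - 1) * (1 / 4 + 2 * ((1 - q) / 4) + 5 * u)) := by
    convert! (((hN.mul_left (1 / 4)).add (h0.mul_left (9 / 4))).add (h1.mul_left 5)).add
      ((((h0.mul_left (1 / 4)).add (h1.mul_left 2)).add
        (hs.hasSum.mul_left 5)).mul_left ((m : ℝ) - 1)) using 1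
    · funext x
      have := total_nonneg x
      rw [hL, factorSq_of_pos _ (by positivity)]
      field_simp
      ring
    · ring
  rw [estML_eq_estShift, risk_estShift hlam le_rfl hV (by simpa using h1), hL]
  have hq : 0 < q := Real.exp_pos _
  have hq' : q < 1 / 33 := by
    have h3 : (2.7182818283 : ℝ) ^ 4 < Real.exp 4 := by
      rw [show (4 : ℝ) = (4 : ℕ) * 1 by norm_num, Real.exp_nat_mul]
      gcongr
      exact Real.exp_one_gt_d9
    change Real.exp (-4) < 1 / 33
    rw [Real.exp_neg, ← one_div]
    apply one_div_lt_one_div_of_lt (by norm_num)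
    refine lt_trans (by norm_num) h3
  rw [ENNReal.ofReal_lt_ofReal_iff_of_nonneg (by linarith)]
  have : 0 ≤ ((m : ℝ) - 1) * (1 / 4 + 2 * ((1 - q) / 4) + 5 * u - 1) :=
    mul_nonneg (by linarith) (by linarith)
  linarith

theorem risk_estO_le (hm : 2 ≤ m) (hlam : ∀ i, 0 < lam i) :
    risk m (estO m) lam ≤ ENNReal.ofReal ((m : ℝ) - 1 / 2) := by
  have hm' : (2 : ℝ) ≤ m := by exact_mod_cast hm
  have hL : 0 < ∑ i, lam i :=
    Finset.sum_pos (fun i _ => hlam i) ⟨⟨0, by omega⟩, Finset.mem_univ _⟩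
  have hk : 0 ≤ (m : ℝ) - 1 := by linarith
  have h0 := hasSum_poissonWeight hlam
  have hN := hasSum_total hlam
  have h1 := hasSum_one_div_total_succ hlam hL.ne'
  have ht := (summable_one_div_total hlam hk).hasSum
  have hu : Summable (fun x => 1 / ((∑ j, (x j : ℝ)) + (m - 1)) * poissonWeight lam x) := by
    have h2 : (1 : ℝ) + (m - 2) = m - 1 := by ring
    simpa only [add_assoc, h2] using
      summable_one_div_total hlam (k := (m : ℝ) - 2) (by linarith)
  have hrel := (hasSum_total_mul_poissonWeight (g := fun n => 1 / (n + ((m : ℝ) - 1))) ht).unique (by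
    convert! h0.sub (hu.hasSum.mul_left ((m : ℝ) - 1)) using 1
    funext x
    have := total_nonneg x
    have h2 : (∑ j, (x j : ℝ)) + ((m : ℝ) - 1) ≠ 0 := by linarith
    field_simp
    ring)
  have hle := hasSum_le (fun x => by
    have := total_nonneg x
    refine mul_le_mul_of_nonneg_right ?_ (poissonWeight_nonneg hlam x)
    apply one_div_le_one_div_of_le <;> linarith) hu.hasSum h1
  have hu0 := hu.hasSum.nonneg fun x => by
    have := total_nonneg x
    have := poissonWeight_nonneg hlam x
    positivity
  set L := ∑ i, lam i
  set t := ∑' x : Fin m → ℕ, 1 / ((∑ j, (x j : ℝ)) + 1 + ((m : ℝ) - 1)) * poissonWeight lam x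
  set u := ∑' x : Fin m → ℕ, 1 / ((∑ j, (x j : ℝ)) + ((m : ℝ) - 1)) * poissonWeight lam x
  have hV : HasSum (fun x => factorSq L ((∑ j, (x j : ℝ)) + 1 + ((m : ℝ) - 1))
      * ((∑ j, (x j : ℝ)) + m) * poissonWeight lam x)
      (1 / 4 * L + (m / 4 + L / 2) * 1 + (L + L ^ 2) / 4 * t) := by
    convert! ((hN.mul_left (1 / 4)).add (h0.mul_left (m / 4 + L / 2))).add
      (ht.mul_left ((L + L ^ 2) / 4)) using 1
    funext x
    have := total_nonneg x
    have h3 : (∑ j, (x j : ℝ)) + 1 + ((m : ℝ) - 1) = (∑ j, (x j : ℝ)) + m := by ring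
    rw [h3, factorSq_of_pos _ (by positivity)]
    field_simp
    ring
  rw [estO_eq_estShift, risk_estShift hlam hk hV ht]
  apply ENNReal.ofReal_le_ofReal
  have h4 : L * u ≤ 1 := by
    rw [le_div_iff₀ hL] at hle
    linarith [Real.exp_pos (-L)]
  have h5 : 0 ≤ ((m : ℝ) - 1) * (3 - (3 * L - 1) * u) :=
    mul_nonneg hk (by linarith)
  linear_combination (1 / 4) * h5 + (1 - 3 * L) / 4 * hrel

end PoissonWeights

/- STATEMENT 9: for every m ≥ 1 there is a parameter point where the risk of λ^ML
exceeds m − 1/2; consequently, for m ≥ 2 the maximum likelihood estimator is not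
minimax: sup_λ R(λ^ML, λ) > sup_λ R(λ^O, λ). -/
theorem stmt_9 (m : ℕ) (hm : 1 ≤ m) :
    (∃ lam : Fin m → ℝ, (∀ i, 0 < lam i) ∧
      ENNReal.ofReal ((m : ℝ) - 1 / 2) < risk m (estML m) lam) ∧
    (2 ≤ m →
      (⨆ lam ∈ {l : Fin m → ℝ | ∀ i, 0 < l i}, risk m (estO m) lam) <
        ⨆ lam ∈ {l : Fin m → ℝ | ∀ i, 0 < l i}, risk m (estML m) lam) := by
  have hm' : (0 : ℝ) < m := by exact_mod_cast hm
  have hpos : ∀ i : Fin m, (0 : ℝ) < (fun _ => 4 / (m : ℝ)) i := fun _ => by positivity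
  have hlt := lt_risk_estML hm hpos (by
    rw [Finset.sum_const, Finset.card_univ, Fintype.card_fin, nsmul_eq_mul]
    field_simp)
  refine ⟨⟨_, hpos, hlt⟩, fun h2 => ?_⟩
  refine (iSup₂_le fun lam hlam => risk_estO_le h2 hlam).trans_lt (hlt.trans_le ?_)
  exact le_iSup₂_of_le (f := fun lam (_ : lam ∈ {l : Fin m → ℝ | ∀ i, 0 < l i}) =>
    risk m (estML m) lam) _ hpos le_rfl
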